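/- Let μ₁,…,μ_N ∈ P₂(ℝⁿ) and weights λ₁,…,λ_N ∈ (0,1) with Σλᵢ = 1, and let μ minimize μ ↦ Σᵢ λᵢ W₂²(μ, μᵢ). Suppose B ⊆ {1,…,N} is nonempty and for each i ∈ B, μᵢ is absolutely continuous with density gᵢ ∈ L^∞. Then μ is absolutely continuous with density g satisfying ‖g‖_{L^∞} ≤ [ Σ_{i∈B} λᵢ / ‖gᵢ‖_{L^∞}^{1/n} ]^{−n}. -/

import Mathlib

open MeasureTheory Set

noncomputable section

/-- `ℝⁿ` with the Euclidean norm. -/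
abbrev En (n : ℕ) := EuclideanSpace ℝ (Fin n)

/-- `γ` is a coupling of `μ` and `ν`. -/
def IsCoupling {n : ℕ} (γ : Measure (En n × En n)) (μ ν : Measure (En n)) : Prop :=
  γ.map Prod.fst = μ ∧ γ.map Prod.snd = ν

/-- The squared quadratic Wasserstein distance `W₂²(μ,ν)`. -/
def W2sq {n : ℕ} (μ ν : Measure (En n)) : ℝ :=
  sInf { c | ∃ γ : Measure (En n × En n), IsCoupling γ μ ν ∧ c = ∫ p, ‖p.1 - p.2‖ ^ 2 ∂γ }

/-- `μ` has finite second moment. -/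
def FinSecMom {n : ℕ} (μ : Measure (En n)) : Prop := Integrable (fun x => ‖x‖ ^ 2) μ

/-- The curve `t ↦ μ t` is weakly continuous on `s`. -/
def WeakContOn {n : ℕ} (μ : ℝ → Measure (En n)) (s : Set ℝ) : Prop :=
  ∀ f : BoundedContinuousFunction (En n) ℝ, ContinuousOn (fun t => ∫ x, f x ∂(μ t)) s

/-- `μb` is a barycenter of the curve `t ↦ μ t`, `t ∈ [0,1]`: it minimizes
`ν ↦ ∫₀¹ W₂²(μ_t, ν) dt` over probability measures with finite second moment. -/
def IsBarycenter {n : ℕ} (μ : ℝ → Measure (En n)) (μb : Measure (En n)) : Prop :=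
  IsProbabilityMeasure μb ∧ FinSecMom μb ∧
    ∀ ν : Measure (En n), IsProbabilityMeasure ν → FinSecMom ν →
      ∫ t in Icc (0:ℝ) 1, W2sq (μ t) μb ≤ ∫ t in Icc (0:ℝ) 1, W2sq (μ t) ν

open Filter Topology
open scoped RealInnerProductSpace MeasureTheory ENNReal

/-- `f` is cyclically monotone on `s`: no rearrangement of finitely many values of `f` on `s`
increases their correlation with the points. -/
def CyclicMonotoneOn {E : Type*} [NormedAddCommGroup E] [InnerProductSpace ℝ E]
    (f : E → E) (s : Set E) : Prop :=
  ∀ (m : ℕ) (v : Fin m → E), (∀ k, v k ∈ s) → ∀ σ : Equiv.Perm (Fin m),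
    ∑ k, ⟪f (v k), v (σ k)⟫ ≤ ∑ k, ⟪f (v k), v k⟫

section LinearAlgebra

variable {E : Type*} [NormedAddCommGroup E] [InnerProductSpace ℝ E]

lemma CyclicMonotoneOn.inner_map_self_nonneg {A : E →L[ℝ] E} (hA : CyclicMonotoneOn A univ)
    (v : E) : 0 ≤ ⟪A v, v⟫ := by
  have h := hA 2 ![v, 0] (fun _ => mem_univ _) (Equiv.swap 0 1)
  simpa [Fin.sum_univ_two] using h

/-- The cyclic monotonicity inequality along a regular `m`-gon in the plane spanned by
`e` and `f`, averaged with its rotation by a right angle. -/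
lemma CyclicMonotoneOn.polygon {A : E →L[ℝ] E} (hA : CyclicMonotoneOn A univ) (e f : E)
    {m : ℕ} (hm : 0 < m) :
    Real.sin (2 * Real.pi / m) * (⟪A e, f⟫ - ⟪A f, e⟫)
      ≤ (1 - Real.cos (2 * Real.pi / m)) * (⟪A e, e⟫ + ⟪A f, f⟫) := by
  set θ : ℝ := 2 * Real.pi / m with hθ
  obtain ⟨l, rfl⟩ : ∃ l, m = l + 1 := ⟨m - 1, by omega⟩
  let p : E → E → ℝ → E := fun e f t => Real.cos t • e + Real.sin t • f
  have hrot (e f : E) (k : Fin (l + 1)) :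
      p e f ((finRotate (l + 1) k : ℕ) * θ) = p e f ((k : ℕ) * θ + θ) := by
    rcases lt_or_eq_of_le (Nat.lt_succ_iff.mp k.2) with hk | hk
    · rw [coe_finRotate_of_ne_last (by intro h; simp [h] at hk)]
      congr 1; push_cast; ring
    · have : k = Fin.last l := Fin.ext hk
      subst this
      have h2 : (l : ℝ) * θ + θ = 2 * Real.pi := by
        rw [hθ]; push_cast; field_simp
      simp [p, h2]
  have hpoly (e f : E) := hA (l + 1) (fun k => p e f ((k : ℕ) * θ)) (fun _ => mem_univ _)
    (finRotate (l + 1))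
  have h1 := hpoly e f
  have h2 := hpoly f (-e)
  simp only [hrot] at h1 h2
  rw [← sub_nonneg, ← Finset.sum_sub_distrib] at h1 h2
  have h3 := add_nonneg h1 h2
  rw [← Finset.sum_add_distrib] at h3
  have key (t : ℝ) : ⟪A (p e f t), p e f t⟫ - ⟪A (p e f t), p e f (t + θ)⟫
      + (⟪A (p f (-e) t), p f (-e) t⟫ - ⟪A (p f (-e) t), p f (-e) (t + θ)⟫)
      = (1 - Real.cos θ) * (⟪A e, e⟫ + ⟪A f, f⟫) - Real.sin θ * (⟪A e, f⟫ - ⟪A f, e⟫) := by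
    simp only [p, map_add, map_smul, map_neg, inner_add_left, inner_add_right,
      real_inner_smul_left, real_inner_smul_right, inner_neg_left, inner_neg_right,
      Real.cos_add, Real.sin_add]
    linear_combination ((1 - Real.cos θ) * (⟪A e, e⟫ + ⟪A f, f⟫)
      - Real.sin θ * (⟪A e, f⟫ - ⟪A f, e⟫)) * (Real.sin_sq_add_cos_sq t)
  simp only [key, Finset.sum_const, Finset.card_univ, Fintype.card_fin, nsmul_eq_mul] at h3
  have := nonneg_of_mul_nonneg_right h3 (by positivity)
  linarith

lemma CyclicMonotoneOn.inner_map_comm {A : E →L[ℝ] E} (hA : CyclicMonotoneOn A univ) (e f : E) :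
    ⟪A e, f⟫ = ⟪A f, e⟫ := by
  have key (e f : E) : ⟪A e, f⟫ - ⟪A f, e⟫ ≤ 0 := by
    set ω := ⟪A e, f⟫ - ⟪A f, e⟫
    set τ := ⟪A e, e⟫ + ⟪A f, f⟫
    have hlim : Tendsto (fun m : ℕ => 2 * Real.pi / (m : ℝ)) atTop (𝓝[≠] 0) := by
      refine tendsto_nhdsWithin_iff.2 ⟨tendsto_const_div_atTop_nhds_zero_nat _, ?_⟩
      filter_upwards [eventually_gt_atTop 0] with m hm
      simp only [mem_compl_iff, mem_singleton_iff]
      positivity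
    have hs : Tendsto (fun t : ℝ => t⁻¹ * Real.sin t) (𝓝[≠] 0) (𝓝 1) := by
      simpa [hasDerivAt_iff_tendsto_slope, slope_fun_def] using! Real.hasDerivAt_sin 0
    have hc : Tendsto (fun t : ℝ => t⁻¹ * (1 - Real.cos t)) (𝓝[≠] 0) (𝓝 0) := by
      have := (Real.hasDerivAt_cos 0).const_sub 1
      simpa [hasDerivAt_iff_tendsto_slope, slope_fun_def] using! this
    have h1 := (hs.comp hlim).mul_const ω
    have h2 := (hc.comp hlim).mul_const τ
    rw [one_mul] at h1
    rw [zero_mul] at h2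
    refine le_of_tendsto_of_tendsto h1 h2 ?_
    filter_upwards [eventually_gt_atTop 0] with m hm
    have := hA.polygon e f hm
    simp only [Function.comp_apply, mul_assoc]
    gcongr
  linarith [key e f, key f e]

variable [FiniteDimensional ℝ E]

/-- Arithmetic-geometric mean inequality for the eigenvalues of a cyclically monotone
linear map. -/
lemma CyclicMonotoneOn.abs_det_rpow_le {A : E →L[ℝ] E} (hA : CyclicMonotoneOn A univ)
    {n : ℕ} (hn : 0 < n) (hE : Module.finrank ℝ E = n) :
    |A.det| ^ ((1 : ℝ) / n) ≤ (LinearMap.trace ℝ E A) / n := by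
  have hsym : (A : E →ₗ[ℝ] E).IsSymmetric := fun x y => by
    rw [ContinuousLinearMap.coe_coe, hA.inner_map_comm, real_inner_comm]
  have hpos : (A : E →ₗ[ℝ] E).IsPositive :=
    ⟨hsym, fun x => by simpa using hA.inner_map_self_nonneg x⟩
  have hnn := hpos.nonneg_eigenvalues hE
  have hdet : A.det = ∏ i, hsym.eigenvalues hE i := by
    simpa using hsym.det_eq_prod_eigenvalues hE
  have htr := hsym.trace_eq_sum_eigenvalues hE
  have hn' : (n : ℝ) ≠ 0 := by positivity
  have h := Real.geom_mean_le_arith_mean_weighted Finset.univ (fun _ : Fin n => (1 : ℝ) / n)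
    (hsym.eigenvalues hE) (fun _ _ => by positivity) (by simp [hn']) (fun i _ => hnn i)
  rw [hdet, abs_of_nonneg (Finset.prod_nonneg fun i _ => hnn i),
    ← Real.finsetProd_rpow _ _ (fun i _ => hnn i)]
  rw [htr, RCLike.ofReal_real_eq_id, id, Finset.sum_div]
  simpa [div_eq_inv_mul] using h

end LinearAlgebra

section Linearization

variable {E : Type*} [NormedAddCommGroup E]

/-- At a Lebesgue density point, every direction is tangent to the set. -/
lemma exists_tendsto_of_density_one [NormedSpace ℝ E] [FiniteDimensional ℝ E]
    [MeasurableSpace E] [BorelSpace E] (μ : Measure E) [μ.IsAddHaarMeasure] {s : Set E} {x : E}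
    (hs : Tendsto (fun r => μ (s ∩ Metric.closedBall x r) / μ (Metric.closedBall x r))
      (𝓝[>] 0) (𝓝 1)) (hx : x ∈ s) (v : E) :
    ∃ d : ℝ → E, (∀ r, x + d r ∈ s) ∧ Tendsto d (𝓝[>] 0) (𝓝 0) ∧
      Tendsto (fun r => r⁻¹ • d r) (𝓝[>] 0) (𝓝 v) := by
  have hne : s.Nonempty := ⟨x, hx⟩
  have hex (r : ℝ) : ∃ d : E, x + d ∈ s ∧
      (0 < r → dist (x + r • v) (x + d) < Metric.infDist (x + r • v) s + r * r) := by
    by_cases hr : 0 < r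
    · obtain ⟨y, hy, hd⟩ := (Metric.infDist_lt_iff hne).1
        (lt_add_of_pos_right (Metric.infDist (x + r • v) s) (mul_pos hr hr))
      exact ⟨y - x, by simpa using hy, fun _ => by simpa using hd⟩
    · exact ⟨0, by simpa using hx, fun h => absurd h hr⟩
  choose d hds hd using hex
  have hlim : Tendsto (fun r => r⁻¹ • d r) (𝓝[>] 0) (𝓝 v) := by
    rw [Metric.tendsto_nhds]
    intro ε hε
    filter_upwards [Measure.eventually_nonempty_inter_smul_of_density_one μ s x hs _
      measurableSet_closedBall (Metric.measure_closedBall_pos μ v (half_pos hε)).ne',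
      Ioo_mem_nhdsGT (half_pos hε)] with r hr hr0
    obtain ⟨y, hys, hy⟩ := hr
    obtain ⟨w, hw, hwy⟩ : ∃ w ∈ Metric.closedBall v (ε / 2), r • w = -x + y := by
      simpa [Set.mem_smul_set] using hy
    obtain rfl : x + r • w = y := by rw [hwy]; abel
    have h1 := hd r hr0.1
    have h2 : Metric.infDist (x + r • v) s ≤ r * (ε / 2) := by
      refine (Metric.infDist_le_dist_of_mem hys).trans ?_
      rw [dist_add_left, dist_smul₀, Real.norm_of_nonneg hr0.1.le, dist_comm]
      exact mul_le_mul_of_nonneg_left hw hr0.1.le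
    rw [dist_add_left] at h1
    have h3 : dist (r⁻¹ • d r) v = r⁻¹ * dist (r • v) (d r) := by
      conv_lhs => rw [← inv_smul_smul₀ hr0.1.ne' v]
      rw [dist_smul₀, norm_inv, Real.norm_of_nonneg hr0.1.le, dist_comm]
    rw [h3, inv_mul_lt_iff₀ hr0.1]
    nlinarith [hr0.1, hr0.2]
  refine ⟨d, hds, ?_, hlim⟩
  have h0 : Tendsto (fun r : ℝ => r) (𝓝[>] 0) (𝓝 0) := nhdsWithin_le_nhds
  have := h0.smul hlim
  rw [zero_smul] at this
  refine this.congr' ?_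
  filter_upwards [self_mem_nhdsWithin] with r hr
  exact smul_inv_smul₀ (ne_of_gt hr) _

variable [InnerProductSpace ℝ E]

lemma CyclicMonotoneOn.of_hasFDerivWithinAt {f : E → E} {s : Set E} (hf : CyclicMonotoneOn f s)
    {A : E →L[ℝ] E} {x : E} (hA : HasFDerivWithinAt f A s x)
    (htan : ∀ v : E, ∃ d : ℝ → E, (∀ r, x + d r ∈ s) ∧ Tendsto d (𝓝[>] 0) (𝓝 0) ∧
      Tendsto (fun r => r⁻¹ • d r) (𝓝[>] 0) (𝓝 v)) :
    CyclicMonotoneOn A univ := by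
  intro m v _ σ
  choose d hds hd0 hdv using fun k => htan (v k)
  have hlim (k : Fin m) := hA.lim (hd0 k) (Eventually.of_forall (hds k)) (hdv k)
  have h1 : Tendsto (fun r : ℝ => ∑ k, ⟪r⁻¹ • (f (x + d k r) - f x),
      r⁻¹ • d (σ k) r - r⁻¹ • d k r⟫) (𝓝[>] 0) (𝓝 (∑ k, ⟪A (v k), v (σ k) - v k⟫)) :=
    tendsto_finsetSum _ fun k _ => (hlim k).inner ((hdv (σ k)).sub (hdv k))
  have h2 : ∑ k, ⟪A (v k), v (σ k) - v k⟫ ≤ 0 := by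
    refine le_of_tendsto h1 (Eventually.of_forall fun r => ?_)
    have h3 := hf m (fun k => x + d k r) (fun k => hds k r) σ
    have h4 : ∑ k, (d (σ k) r - d k r) = 0 := by
      rw [Finset.sum_sub_distrib, Equiv.sum_comp σ (fun k => d k r), sub_self]
    have h5 : ∑ k, ⟪r⁻¹ • (f (x + d k r) - f x), r⁻¹ • d (σ k) r - r⁻¹ • d k r⟫
        = r⁻¹ * r⁻¹ * (∑ k, ⟪f (x + d k r), x + d (σ k) r⟫ - ∑ k, ⟪f (x + d k r), x + d k r⟫
          - ⟪f x, ∑ k, (d (σ k) r - d k r)⟫) := by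
      rw [inner_sum, ← Finset.sum_sub_distrib, ← Finset.sum_sub_distrib, Finset.mul_sum]
      refine Finset.sum_congr rfl fun k _ => ?_
      rw [← smul_sub, real_inner_smul_left, real_inner_smul_right]
      simp only [inner_sub_left, inner_sub_right, inner_add_right]
      ring
    rw [h5, h4, inner_zero_right, sub_zero]
    exact mul_nonpos_of_nonneg_of_nonpos (mul_self_nonneg _) (by linarith)
  simp only [inner_sub_right, Finset.sum_sub_distrib] at h2
  linarith

variable [FiniteDimensional ℝ E] [MeasurableSpace E] [BorelSpace E]

/-- If Lipschitz cyclically monotone maps average to the identity on `s`, then so do their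
derivatives almost everywhere on `s`, whence the bound on the determinants. -/
lemma ae_sum_abs_det_fderivWithin_le {ι : Type*} [Fintype ι] {n : ℕ} (hn : 0 < n)
    (hE : Module.finrank ℝ E = n) (μ : Measure E) [μ.IsAddHaarMeasure] {s : Set E}
    (hs : MeasurableSet s) {T : ι → E → E} {K : ι → NNReal} {lam : ι → ℝ}
    (hlam : ∀ i, 0 ≤ lam i) (hT : ∀ i, LipschitzOnWith (K i) (T i) s)
    (hcyc : ∀ i, CyclicMonotoneOn (T i) s) (hsum : ∀ x ∈ s, ∑ i, lam i • T i x = x) :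
    ∀ᵐ x ∂μ, x ∈ s → (∀ i, DifferentiableWithinAt ℝ (T i) s x) ∧
      ∑ i, lam i * |(fderivWithin ℝ (T i) s x).det| ^ ((1 : ℝ) / n) ≤ 1 := by
  have hdiff : ∀ᵐ x ∂μ, ∀ i, x ∈ s → DifferentiableWithinAt ℝ (T i) s x :=
    ae_all_iff.2 fun i => (hT i).ae_differentiableWithinAt_of_mem
  filter_upwards [hdiff, (ae_restrict_iff' hs).1 (Besicovitch.ae_tendsto_measure_inter_div μ s)]
    with x hx hdens hxs
  refine ⟨fun i => hx i hxs, ?_⟩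
  have htan := exists_tendsto_of_density_one μ (hdens hxs) hxs
  set A : ι → E →L[ℝ] E := fun i => fderivWithin ℝ (T i) s x
  have hA (i : ι) : HasFDerivWithinAt (T i) (A i) s x := (hx i hxs).hasFDerivWithinAt
  have hAmono (i : ι) := (hcyc i).of_hasFDerivWithinAt (hA i) htan
  have hAsum : ∑ i, lam i • A i = ContinuousLinearMap.id ℝ E := by
    have h1 : HasFDerivWithinAt (fun y => ∑ i, lam i • T i y) (∑ i, lam i • A i) s x :=
      HasFDerivWithinAt.fun_sum fun i _ => (hA i).const_smul (lam i)
    have h2 : HasFDerivWithinAt (fun y => ∑ i, lam i • T i y) (ContinuousLinearMap.id ℝ E) s x :=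
      (hasFDerivWithinAt_id x s).congr (fun y hy => hsum y hy) (hsum x hxs)
    ext1 v
    obtain ⟨d, hds, hd0, hdv⟩ := htan v
    exact tendsto_nhds_unique (h1.lim hd0 (Eventually.of_forall hds) hdv)
      (h2.lim hd0 (Eventually.of_forall hds) hdv)
  have htr : ∑ i, lam i * LinearMap.trace ℝ E (A i) = n := by
    have := congrArg (fun B : E →L[ℝ] E => LinearMap.trace ℝ E (B : E →ₗ[ℝ] E)) hAsum
    simpa [hE] using this
  calc ∑ i, lam i * |(A i).det| ^ ((1 : ℝ) / n)
      ≤ ∑ i, lam i * (LinearMap.trace ℝ E (A i) / n) := Finset.sum_le_sum fun i _ =>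
        mul_le_mul_of_nonneg_left ((hAmono i).abs_det_rpow_le hn hE) (hlam i)
    _ = 1 := by
        simp only [← mul_div_assoc, ← Finset.sum_div, htr]
        exact div_self (by positivity)

end Linearization

section Density

variable {E : Type*} [NormedAddCommGroup E] [InnerProductSpace ℝ E] [FiniteDimensional ℝ E]
  [MeasurableSpace E] [BorelSpace E]

lemma LipschitzOnWith.addHaar_image_eq_zero {μ : Measure E} [μ.IsAddHaarMeasure] {K : NNReal}
    {f : E → E} {s : Set E} (hf : LipschitzOnWith K f s) (hs : μ s = 0) : μ (f '' s) = 0 := by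
  have h0 : (μH[(Module.finrank ℝ E : ℝ)] : Measure E) s = 0 :=
    Measure.absolutelyContinuous_isAddHaarMeasure _ μ hs
  have h1 := hf.hausdorffMeasure_image_le (d := Module.finrank ℝ E) (by positivity)
  rw [h0, mul_zero, nonpos_iff_eq_zero] at h1
  exact Measure.absolutelyContinuous_isAddHaarMeasure μ _ h1

/-- A measure dominated by the volumes of its images under Lipschitz cyclically monotone maps
averaging to the identity has bounded density. -/
lemma exists_density_of_measure_le_image {ι : Type*} [Fintype ι] {n : ℕ} (hn : 0 < n)
    (hE : Module.finrank ℝ E = n) (vol : Measure E) [vol.IsAddHaarMeasure] {s : Set E}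
    (hs : MeasurableSet s) {T : ι → E → E} {K : ι → NNReal} {lam : ι → ℝ}
    (hlam : ∀ i, 0 < lam i) (hT : ∀ i, LipschitzOnWith (K i) (T i) s)
    (hcyc : ∀ i, CyclicMonotoneOn (T i) s) (hsum : ∀ x ∈ s, ∑ i, lam i • T i x = x)
    (μ : Measure E) [IsFiniteMeasure μ] {B : Finset ι} (hB : B.Nonempty) {C : ι → ℝ}
    (hC : ∀ i ∈ B, 0 < C i)
    (hμ : ∀ i ∈ B, ∀ A, MeasurableSet A → μ A ≤ ENNReal.ofReal (C i) * vol (T i '' (A ∩ s))) :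
    ∃ g : E → ℝ, μ = vol.withDensity (fun x => ENNReal.ofReal (g x)) ∧
      eLpNorm g ⊤ vol ≤
        ENNReal.ofReal ((∑ i ∈ B, lam i / C i ^ ((1:ℝ) / n)) ^ (-(n:ℝ))) := by
  have hae := ae_sum_abs_det_fderivWithin_le hn hE vol hs (fun i => (hlam i).le) hT hcyc hsum
  set D : ι → E → E →L[ℝ] E := fun i x => fderivWithin ℝ (T i) s x with hD
  set bad : Set E := toMeasurable vol {x | ¬ (x ∈ s → (∀ i, DifferentiableWithinAt ℝ (T i) s x) ∧
      ∑ i, lam i * |(D i x).det| ^ ((1 : ℝ) / n) ≤ 1)} with hbad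
  have hbad0 : vol bad = 0 := by rw [hbad, measure_toMeasurable]; exact hae
  have hbadm : MeasurableSet bad := measurableSet_toMeasurable _ _
  have hgood (x : E) (hxs : x ∈ s) (hx : x ∉ bad) :
      (∀ i, DifferentiableWithinAt ℝ (T i) s x) ∧
        ∑ i, lam i * |(D i x).det| ^ ((1 : ℝ) / n) ≤ 1 := by
    by_contra h
    exact hx (subset_toMeasurable vol _ fun h' => h (h' hxs))
  have hμle (i : ι) (hi : i ∈ B) (A : Set E) (hA : MeasurableSet A) : μ A ≤
      ∫⁻ x in A, (s \ bad).indicator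
        (fun x => ENNReal.ofReal (C i) * ENNReal.ofReal |(D i x).det|) x ∂vol := by
    have h0 : vol (T i '' (A ∩ s ∩ bad)) = 0 :=
      ((hT i).mono (by intro x hx; exact hx.1.2)).addHaar_image_eq_zero
        (measure_mono_null inter_subset_right hbad0)
    have h1 : vol (T i '' (A ∩ (s \ bad))) ≤
        ∫⁻ x in A ∩ (s \ bad), ENNReal.ofReal |(D i x).det| ∂vol :=
      addHaar_image_le_lintegral_abs_det_fderiv vol (hA.inter (hs.diff hbadm)) fun x hx =>
        ((hgood x hx.2.1 hx.2.2).1 i).hasFDerivWithinAt.mono fun y hy => hy.2.1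
    have h2 : T i '' (A ∩ s) ⊆ T i '' (A ∩ (s \ bad)) ∪ T i '' (A ∩ s ∩ bad) := by
      rw [← image_union]
      refine image_mono fun x hx => ?_
      by_cases hxb : x ∈ bad
      · exact Or.inr ⟨hx, hxb⟩
      · exact Or.inl ⟨hx.1, hx.2, hxb⟩
    rw [setLIntegral_indicator (hs.diff hbadm), inter_comm, lintegral_const_mul']
    · calc μ A ≤ ENNReal.ofReal (C i) * vol (T i '' (A ∩ s)) := hμ i hi A hA
        _ ≤ _ := by
          gcongr
          exact (measure_mono h2).trans ((measure_union_le _ _).trans (by simpa [h0] using h1))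
    · exact ENNReal.ofReal_ne_top
  obtain ⟨i₀, hi₀⟩ := hB
  have hac : μ ≪ vol := by
    refine Measure.AbsolutelyContinuous.mk fun A hA hA0 => ?_
    have := hμle i₀ hi₀ A hA
    rwa [Measure.restrict_eq_zero.2 hA0, lintegral_zero_measure, nonpos_iff_eq_zero] at this
  set ρ := μ.rnDeriv vol
  have hρ : vol.withDensity ρ = μ := Measure.withDensity_rnDeriv_eq μ vol hac
  have hρle : ∀ᵐ x ∂vol, ∀ i, i ∈ B → ρ x ≤ (s \ bad).indicator
        (fun x => ENNReal.ofReal (C i) * ENNReal.ofReal |(D i x).det|) x := by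
    refine ae_all_iff.2 fun i => ?_
    by_cases hi : i ∈ B
    · have : ρ ≤ᵐ[vol] (s \ bad).indicator
          (fun x => ENNReal.ofReal (C i) * ENNReal.ofReal |(D i x).det|) :=
        ae_le_of_forall_setLIntegral_le_of_sigmaFinite₀
          (Measure.measurable_rnDeriv μ vol).aemeasurable fun A hA _ => by
            rw [← withDensity_apply _ hA, hρ]
            exact hμle i hi A hA
      filter_upwards [this] with x hx _
      exact hx
    · exact Eventually.of_forall fun x h => absurd h hi
  have hMpos : 0 < ∑ i ∈ B, lam i / C i ^ ((1:ℝ) / n) :=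
    Finset.sum_pos (fun i hi => div_pos (hlam i) (Real.rpow_pos_of_pos (hC i hi) _)) ⟨i₀, hi₀⟩
  refine ⟨fun x => (ρ x).toReal, ?_, ?_⟩
  · conv_lhs => rw [← hρ]
    refine withDensity_congr_ae ?_
    filter_upwards [Measure.rnDeriv_lt_top μ vol] with x hx
    exact (ENNReal.ofReal_toReal hx.ne).symm
  · rw [eLpNorm_exponent_top]
    refine eLpNormEssSup_le_of_ae_bound ?_
    filter_upwards [hρle] with x hx
    rw [Real.norm_of_nonneg ENNReal.toReal_nonneg]
    by_cases hxs : x ∈ s \ bad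
    · have hle (i : ι) (hi : i ∈ B) : (ρ x).toReal ≤ C i * |(D i x).det| := by
        have := hx i hi
        rw [indicator_of_mem hxs, ← ENNReal.ofReal_mul (hC i hi).le] at this
        exact ENNReal.toReal_le_of_le_ofReal (by have := hC i hi; positivity) this
      set r := (ρ x).toReal
      have hr : 0 ≤ r := ENNReal.toReal_nonneg
      have hmul : r ^ ((1:ℝ) / n) * ∑ i ∈ B, lam i / C i ^ ((1:ℝ) / n) ≤ 1 := by
        refine le_trans ?_ (hgood x hxs.1 hxs.2).2
        rw [Finset.mul_sum]
        refine (Finset.sum_le_sum fun i hi => ?_).trans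
          (Finset.sum_le_univ_sum_of_nonneg fun i =>
            mul_nonneg (hlam i).le (Real.rpow_nonneg (abs_nonneg _) _))
        have hCi := Real.rpow_pos_of_pos (hC i hi) ((1:ℝ) / n)
        rw [mul_div_left_comm]
        refine mul_le_mul_of_nonneg_left ?_ (hlam i).le
        rw [div_le_iff₀ hCi, mul_comm, ← Real.mul_rpow (hC i hi).le (abs_nonneg _)]
        exact Real.rpow_le_rpow hr (hle i hi) (by positivity)
      have hn' : (n : ℝ) ≠ 0 := by positivity
      calc r = (r ^ ((1:ℝ) / n)) ^ (n : ℝ) := by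
            rw [← Real.rpow_mul hr, one_div_mul_cancel hn', Real.rpow_one]
        _ ≤ ((∑ i ∈ B, lam i / C i ^ ((1:ℝ) / n))⁻¹) ^ (n : ℝ) := by
            refine Real.rpow_le_rpow (Real.rpow_nonneg hr _) ?_ (by positivity)
            rwa [← one_div, le_div_iff₀ hMpos]
        _ = _ := by rw [Real.inv_rpow hMpos.le, Real.rpow_neg hMpos.le]
    · have := hx i₀ hi₀
      rw [indicator_of_notMem hxs, nonpos_iff_eq_zero] at this
      rw [this]
      simp only [ENNReal.toReal_zero]
      positivity

end Density

section MultiMarginal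

lemma sum_apply_update {ι E M : Type*} [Fintype ι] [DecidableEq ι] [AddCommGroup M]
    (φ : ι → E → M) (a : ι → E) (i : ι) (w : E) :
    ∑ j, φ j (Function.update a i w j) = ∑ j, φ j (a j) + (φ i w - φ i (a i)) := by
  rw [← Finset.add_sum_erase _ _ (Finset.mem_univ i),
    ← Finset.add_sum_erase _ (fun j => φ j (a j)) (Finset.mem_univ i), Function.update_self,
    Finset.sum_congr rfl fun j hj => by rw [Function.update_of_ne (Finset.ne_of_mem_erase hj)]]
  abel

/-- Cyclic monotonicity of an optimal multi-marginal plan: exchanging the `i`-th components of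
finitely many points of its support does not decrease the total cost. -/
lemma sum_cost_le_sum_cost_update {ι X : Type*} [Fintype ι] [DecidableEq ι] [TopologicalSpace X]
    [SecondCountableTopology X] [MeasurableSpace X] [BorelSpace X] {Γ : Measure (ι → X)}
    [IsProbabilityMeasure Γ] {c : (ι → X) → ℝ} (hc : Continuous c)
    (hopt : ∀ Γ' : Measure (ι → X), IsProbabilityMeasure Γ' →
      (∀ j, Γ'.map (Function.eval j) = Γ.map (Function.eval j)) →
      Integrable c Γ' ∧ ∫ a, c a ∂Γ ≤ ∫ a, c a ∂Γ')
    {m : ℕ} (a : Fin m → ι → X) (ha : ∀ k, a k ∈ Γ.support) (i : ι)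
    (σ : Equiv.Perm (Fin m)) :
    ∑ k, c (a k) ≤ ∑ k, c (Function.update (a k) i (a (σ k) i)) := by
  by_contra! hlt
  have hm : m ≠ 0 := by rintro rfl; simp at hlt
  set P : Measure (Fin m → ι → X) := Measure.pi fun _ => Γ
  have hPk (k : Fin m) : MeasurePreserving (fun z : Fin m → ι → X => z k) P Γ :=
    measurePreserving_eval _ k
  let swap : (Fin m → ι → X) → Fin m → ι → X := fun z k => Function.update (z k) i (z (σ k) i)
  have hswap (k : Fin m) : Continuous fun z => swap z k := by
    refine Continuous.update (by fun_prop) i (by fun_prop)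
  let W : Set (Fin m → ι → X) := {z | ∑ k, c (swap z k) < ∑ k, c (z k)}
  have hW : IsOpen W := isOpen_lt
    (continuous_finsetSum _ fun k _ => hc.comp (hswap k))
    (continuous_finsetSum _ fun k _ => hc.comp (continuous_apply k))
  classical
  let F : (Fin m → ι → X) → Fin m → ι → X := fun z k => if z ∈ W then swap z k else z k
  have hF (k : Fin m) : Measurable fun z => F z k :=
    Measurable.ite hW.measurableSet (hswap k).measurable (measurable_pi_apply k)
  have hperm (f : X → ℝ≥0∞) (j : ι) (z : Fin m → ι → X) :
      ∑ k, f (F z k j) = ∑ k, f (z k j) := by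
    by_cases hz : z ∈ W
    · simp only [F, hz, if_true, swap]
      by_cases hj : j = i
      · subst hj
        simp only [Function.update_self]
        exact Equiv.sum_comp σ fun k => f (z k j)
      · simp only [Function.update_of_ne hj]
    · simp only [F, hz, if_false]
  set Γ' : Measure (ι → X) := (m : ℝ≥0∞)⁻¹ • ∑ k, P.map fun z => F z k with hΓ'
  have hm0 : (m : ℝ≥0∞) ≠ 0 := by exact_mod_cast hm
  have hmarg (j : ι) : Γ'.map (Function.eval j) = Γ.map (Function.eval j) := by
    refine Measure.ext_of_lintegral _ fun f hf => ?_
    rw [lintegral_map hf (measurable_pi_apply j), lintegral_map hf (measurable_pi_apply j), hΓ',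
      lintegral_smul_measure, lintegral_finsetSum_measure]
    have hfj : Measurable fun b : ι → X => f (b j) := hf.comp (measurable_pi_apply j)
    have hfF (k : Fin m) : Measurable fun z => f (F z k j) := hfj.comp (hF k)
    have hfz (k : Fin m) : Measurable fun z : Fin m → ι → X => f (z k j) :=
      hfj.comp (hPk k).measurable
    have hz (k : Fin m) : ∫⁻ z, f (z k j) ∂P = ∫⁻ b, f (b j) ∂Γ := (hPk k).lintegral_comp hfj
    simp only [Function.eval, lintegral_map hfj (hF _)]
    rw [← lintegral_finsetSum _ fun k _ => hfF k]
    simp only [hperm]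
    rw [lintegral_finsetSum _ fun k _ => hfz k]
    simp only [hz]
    rw [Finset.sum_const, Finset.card_univ, Fintype.card_fin, nsmul_eq_mul, smul_eq_mul,
      ← mul_assoc, ENNReal.inv_mul_cancel hm0 (ENNReal.natCast_ne_top m), one_mul]
  have hprob : IsProbabilityMeasure Γ' := by
    constructor
    have := congrArg (fun ν : Measure X => ν univ) (hmarg i)
    simpa [Measure.map_apply (measurable_pi_apply i)] using this
  obtain ⟨hint', hle⟩ := hopt Γ' hprob hmarg
  have hint : Integrable c Γ := (hopt Γ inferInstance fun _ => rfl).1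
  have hintF (k : Fin m) : Integrable (fun z => c (F z k)) P := by
    rw [hΓ', integrable_smul_measure (by simp) (by simpa using hm),
      integrable_finsetSum_measure] at hint'
    exact (integrable_map_measure hc.aestronglyMeasurable (hF k).aemeasurable).1
      (hint' k (Finset.mem_univ k))
  have hintz (k : Fin m) : Integrable (fun z : Fin m → ι → X => c (z k)) P :=
    (hPk k).integrable_comp_of_integrable hint
  have hΓ'int : ∫ a, c a ∂Γ' = (m : ℝ)⁻¹ * ∑ k, ∫ z, c (F z k) ∂P := by
    rw [hΓ', integral_smul_measure, integral_finsetSum_measure]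
    · simp [integral_map (hF _).aemeasurable hc.aestronglyMeasurable]
    · intro k _
      exact (integrable_map_measure hc.aestronglyMeasurable (hF k).aemeasurable).2 (hintF k)
  have hzint : ∑ k, ∫ z, c (z k) ∂P = m * ∫ a, c a ∂Γ := by
    have (k : Fin m) : ∫ z, c (z k) ∂P = ∫ a, c a ∂Γ := by
      rw [← (hPk k).map_eq, integral_map (hPk k).aemeasurable hc.aestronglyMeasurable]
    simp [this]
  have hmpos : (0 : ℝ) < m := by positivity
  have htotal : ∫ z, (∑ k, c (z k) - ∑ k, c (F z k)) ∂P ≤ 0 := by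
    rw [integral_sub (integrable_finsetSum _ fun k _ => hintz k)
      (integrable_finsetSum _ fun k _ => hintF k), integral_finsetSum _ fun k _ => hintz k,
      integral_finsetSum _ fun k _ => hintF k, hzint]
    rw [hΓ'int, ← div_eq_inv_mul, le_div_iff₀ hmpos] at hle
    linarith
  have hnn : 0 ≤ fun z => ∑ k, c (z k) - ∑ k, c (F z k) := by
    intro z
    by_cases hz : z ∈ W
    · simpa [F, hz] using le_of_lt hz
    · simp [F, hz]
  have hae := (integral_eq_zero_iff_of_nonneg hnn ((integrable_finsetSum _ fun k _ => hintz k).sub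
    (integrable_finsetSum _ fun k _ => hintF k))).1 (le_antisymm htotal (integral_nonneg hnn))
  have hPW : P W = 0 := by
    refine measure_mono_null (fun z hz => ?_) hae
    have : ∑ k, c (swap z k) < ∑ k, c (z k) := hz
    simp only [mem_compl_iff, mem_ofPred_eq, F, hz, if_true, Pi.zero_apply]
    linarith
  obtain ⟨u, hu, huW⟩ := isOpen_pi_iff'.1 hW a hlt
  have hbox : P (univ.pi u) = ∏ k, Γ (u k) := Measure.pi_pi _ _
  have hzero := measure_mono_null huW hPW
  rw [hbox, Finset.prod_eq_zero_iff] at hzero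
  obtain ⟨k, -, hk⟩ := hzero
  exact ((Measure.mem_support_iff_forall _).1 (ha k) (u k) ((hu k).1.mem_nhds (hu k).2)).ne' hk

variable {ι E : Type*} [Fintype ι] [NormedAddCommGroup E] [InnerProductSpace ℝ E]

/-- The weighted sum of a family of points. -/
def weightedSum (lam : ι → ℝ) (a : ι → E) : E := ∑ i, lam i • a i

/-- The weighted variance of a family of points. -/
def weightedVar (lam : ι → ℝ) (a : ι → E) : ℝ := ∑ i, lam i * ‖a i - weightedSum lam a‖ ^ 2

lemma continuous_weightedSum (lam : ι → ℝ) : Continuous (weightedSum lam : (ι → E) → E) := by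
  unfold weightedSum
  fun_prop

lemma continuous_weightedVar (lam : ι → ℝ) : Continuous (weightedVar lam : (ι → E) → ℝ) := by
  have := continuous_weightedSum (E := E) lam
  unfold weightedVar
  fun_prop

lemma sum_mul_norm_sub_sq {lam : ι → ℝ} (hsum : ∑ i, lam i = 1) (x : E) (a : ι → E) :
    ∑ i, lam i * ‖x - a i‖ ^ 2 =
      ∑ i, lam i * ‖a i‖ ^ 2 - 2 * ⟪x, weightedSum lam a⟫ + ‖x‖ ^ 2 := by
  have h : ∑ i, lam i * ‖x - a i‖ ^ 2 =
      ∑ i, (lam i * ‖a i‖ ^ 2 - 2 * (lam i * ⟪x, a i⟫) + lam i * ‖x‖ ^ 2) :=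
    Finset.sum_congr rfl fun i _ => by rw [norm_sub_sq_real]; ring
  rw [h, Finset.sum_add_distrib, Finset.sum_sub_distrib, ← Finset.sum_mul, hsum, one_mul,
    ← Finset.mul_sum]
  simp [weightedSum, inner_sum, real_inner_smul_right]

lemma weightedVar_eq {lam : ι → ℝ} (hsum : ∑ i, lam i = 1) (a : ι → E) :
    weightedVar lam a = ∑ i, lam i * ‖a i‖ ^ 2 - ‖weightedSum lam a‖ ^ 2 := by
  have h := sum_mul_norm_sub_sq hsum (weightedSum lam a) a
  simp only [norm_sub_rev (weightedSum lam a)] at h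
  rw [weightedVar, h, real_inner_self_eq_norm_sq]
  ring

/-- The inequality expressing that permuting the `i`-th components of finitely many families
does not decrease the total variance. -/
lemma sum_inner_add_sq_nonpos [DecidableEq ι] {lam : ι → ℝ} (hlam : ∀ i, 0 < lam i)
    (hsum : ∑ i, lam i = 1) {m : ℕ} (a : Fin m → ι → E) (i : ι) (σ : Equiv.Perm (Fin m))
    (h : ∑ k, weightedVar lam (a k) ≤
      ∑ k, weightedVar lam (Function.update (a k) i (a (σ k) i))) :
    ∑ k, (2 * ⟪weightedSum lam (a k), a (σ k) i - a k i⟫ + lam i * ‖a (σ k) i - a k i‖ ^ 2)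
      ≤ 0 := by
  have hupd (k : Fin m) : weightedVar lam (Function.update (a k) i (a (σ k) i)) =
      weightedVar lam (a k) + lam i * (‖a (σ k) i‖ ^ 2 - ‖a k i‖ ^ 2) - lam i *
      (2 * ⟪weightedSum lam (a k), a (σ k) i - a k i⟫ + lam i * ‖a (σ k) i - a k i‖ ^ 2) := by
    have h1 : weightedSum lam (Function.update (a k) i (a (σ k) i)) =
        weightedSum lam (a k) + lam i • (a (σ k) i - a k i) := by
      rw [weightedSum, sum_apply_update (fun j (x : E) => lam j • x), weightedSum, smul_sub]
    rw [weightedVar_eq hsum, weightedVar_eq hsum, h1,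
      sum_apply_update (fun j (x : E) => lam j * ‖x‖ ^ 2), norm_add_sq_real, norm_smul,
      real_inner_smul_right, Real.norm_of_nonneg (hlam i).le]
    ring
  simp only [hupd] at h
  rw [Finset.sum_sub_distrib, Finset.sum_add_distrib, ← Finset.mul_sum, ← Finset.mul_sum,
    Finset.sum_sub_distrib, Equiv.sum_comp σ (fun k => ‖a k i‖ ^ 2)] at h
  have := hlam i
  nlinarith

end MultiMarginal

section Barycentric

variable {ι E : Type*} [Fintype ι] [NormedAddCommGroup E] [InnerProductSpace ℝ E]

/-- Permuting the `i`-th components of finitely many families in `S` does not decrease the total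
variance, in the form of the inequality `sum_inner_add_sq_nonpos`. -/
def SwapMonotoneOn (lam : ι → ℝ) (S : Set (ι → E)) : Prop :=
  ∀ (m : ℕ) (a : Fin m → ι → E), (∀ k, a k ∈ S) → ∀ (i : ι) (σ : Equiv.Perm (Fin m)),
    ∑ k, (2 * ⟪weightedSum lam (a k), a (σ k) i - a k i⟫ + lam i * ‖a (σ k) i - a k i‖ ^ 2) ≤ 0

namespace SwapMonotoneOn

variable {lam : ι → ℝ} {S : Set (ι → E)}

lemma mul_norm_sub_le (hS : SwapMonotoneOn lam S) {a b : ι → E}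
    (ha : a ∈ S) (hb : b ∈ S) (i : ι) :
    lam i * ‖a i - b i‖ ≤ ‖weightedSum lam a - weightedSum lam b‖ := by
  have h := hS 2 ![a, b] (by simp [Fin.forall_fin_two, ha, hb]) i (Equiv.swap 0 1)
  simp only [Fin.sum_univ_two, Equiv.swap_apply_left, Equiv.swap_apply_right,
    Matrix.cons_val_zero, Matrix.cons_val_one] at h
  rw [norm_sub_rev (b i), ← neg_sub (a i) (b i), inner_neg_right] at h
  have h1 : lam i * ‖a i - b i‖ ^ 2 ≤
      ‖weightedSum lam a - weightedSum lam b‖ * ‖a i - b i‖ := by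
    refine le_trans ?_ (real_inner_le_norm _ _)
    rw [inner_sub_left]
    linarith
  rcases (norm_nonneg (a i - b i)).eq_or_lt with h0 | h0
  · rw [← h0, mul_zero]
    exact norm_nonneg _
  · exact le_of_mul_le_mul_right (by linarith) h0

lemma norm_sub_le (hS : SwapMonotoneOn lam S) (hlam : ∀ i, 0 < lam i) {a b : ι → E}
    (ha : a ∈ S) (hb : b ∈ S) (i : ι) :
    ‖a i - b i‖ ≤ (lam i)⁻¹ * ‖weightedSum lam a - weightedSum lam b‖ := by
  rw [← div_eq_inv_mul, le_div_iff₀' (hlam i)]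
  exact hS.mul_norm_sub_le ha hb i

lemma injOn (hS : SwapMonotoneOn lam S) (hlam : ∀ i, 0 < lam i) :
    InjOn (weightedSum lam) S := by
  intro a ha b hb hab
  funext i
  have := hS.norm_sub_le hlam ha hb i
  rw [hab, sub_self, norm_zero, mul_zero] at this
  exact sub_eq_zero.1 (norm_le_zero_iff.1 this)

lemma isClosed_image [CompleteSpace E] (hS : SwapMonotoneOn lam S) (hlam : ∀ i, 0 < lam i)
    (hcl : IsClosed S) : IsClosed (weightedSum lam '' S) := by
  have hanti : AntilipschitzWith (∑ i, (lam i)⁻¹).toNNReal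
      (fun a : S => weightedSum lam (a : ι → E)) := by
    refine AntilipschitzWith.of_le_mul_dist fun a b => ?_
    rw [Subtype.dist_eq, dist_eq_norm, dist_eq_norm,
      Real.coe_toNNReal _ (Finset.sum_nonneg fun i _ => (inv_pos.2 (hlam i)).le)]
    refine (pi_norm_le_iff_of_nonneg (mul_nonneg (Finset.sum_nonneg fun i _ =>
      (inv_pos.2 (hlam i)).le) (norm_nonneg _))).2 fun i => ?_
    refine (hS.norm_sub_le hlam a.2 b.2 i).trans (mul_le_mul_of_nonneg_right ?_ (norm_nonneg _))
    exact Finset.single_le_sum (f := fun i => (lam i)⁻¹) (fun i _ => (inv_pos.2 (hlam i)).le)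
      (Finset.mem_univ i)
  have : CompleteSpace S := hcl.completeSpace_coe
  have huc : UniformContinuous (fun a : S => weightedSum lam (a : ι → E)) := by
    let L : (ι → E) →L[ℝ] E := ∑ i, lam i • ContinuousLinearMap.proj (R := ℝ) i
    have hL : (fun a : S => weightedSum lam (a : ι → E)) = fun a : S => L a := by
      funext a
      simp [L, weightedSum]
    rw [hL]
    exact L.uniformContinuous.comp uniformContinuous_subtype_val
  rw [image_eq_range]
  exact hanti.isClosed_range huc

/-- A set of families on which exchanging components does not decrease the variance is the graph,
over its set of barycentres, of Lipschitz cyclically monotone maps. -/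
lemma exists_maps (hS : SwapMonotoneOn lam S) (hlam : ∀ i, 0 < lam i) :
    ∃ T : ι → E → E, (∀ a ∈ S, ∀ i, T i (weightedSum lam a) = a i) ∧
      (∀ i, LipschitzOnWith (lam i)⁻¹.toNNReal (T i) (weightedSum lam '' S)) ∧
      ∀ i, CyclicMonotoneOn (T i) (weightedSum lam '' S) := by
  have hinv : ∀ a ∈ S, Function.invFunOn (weightedSum lam) S (weightedSum lam a) = a :=
    fun a ha => (hS.injOn hlam).leftInvOn_invFunOn ha
  refine ⟨fun i x => Function.invFunOn (weightedSum lam) S x i,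
    fun a ha i => congrFun (hinv a ha) i, fun i => ?_, fun i m v hv σ => ?_⟩
  · refine LipschitzOnWith.of_dist_le_mul ?_
    rintro _ ⟨a, ha, rfl⟩ _ ⟨b, hb, rfl⟩
    simp only [hinv a ha, hinv b hb, dist_eq_norm, Real.coe_toNNReal _ (inv_pos.2 (hlam i)).le]
    exact hS.norm_sub_le hlam ha hb i
  · choose a ha hav using hv
    obtain rfl : (fun k => weightedSum lam (a k)) = v := funext hav
    simp only [hinv _ (ha _)]
    have h := hS m a ha i σ.symm
    rw [Finset.sum_add_distrib, ← Finset.mul_sum] at h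
    have h2 : 0 ≤ ∑ k, lam i * ‖a (σ.symm k) i - a k i‖ ^ 2 :=
      Finset.sum_nonneg fun k _ => mul_nonneg (hlam i).le (sq_nonneg _)
    simp only [inner_sub_right, Finset.sum_sub_distrib] at h
    have h3 : ∑ k, ⟪weightedSum lam (a k), a (σ.symm k) i⟫ =
        ∑ k, ⟪a k i, weightedSum lam (a (σ k))⟫ := by
      rw [← Equiv.sum_comp σ]
      exact Finset.sum_congr rfl fun k _ => by rw [Equiv.symm_apply_apply, real_inner_comm]
    have h4 : ∑ k, ⟪weightedSum lam (a k), a k i⟫ = ∑ k, ⟪a k i, weightedSum lam (a k)⟫ :=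
      Finset.sum_congr rfl fun k _ => real_inner_comm _ _
    rw [h3, h4] at h
    linarith

end SwapMonotoneOn

variable [FiniteDimensional ℝ E] [MeasurableSpace E] [BorelSpace E]

/-- Density bound for the law of the barycentre of an optimal multi-marginal plan. -/
lemma exists_density_of_optimal_plan [DecidableEq ι] {n : ℕ} (hn : 0 < n)
    (hE : Module.finrank ℝ E = n)
    (vol : Measure E) [vol.IsAddHaarMeasure] {lam : ι → ℝ} (hlam : ∀ i, 0 < lam i)
    (hsum : ∑ i, lam i = 1) {Γ : Measure (ι → E)} [IsProbabilityMeasure Γ]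
    (hopt : ∀ Γ' : Measure (ι → E), IsProbabilityMeasure Γ' →
      (∀ j, Γ'.map (Function.eval j) = Γ.map (Function.eval j)) →
      Integrable (weightedVar lam) Γ' ∧
        ∫ a, weightedVar lam a ∂Γ ≤ ∫ a, weightedVar lam a ∂Γ')
    {B : Finset ι} (hB : B.Nonempty) {C : ι → ℝ} (hC : ∀ i ∈ B, 0 < C i)
    (hμ : ∀ i ∈ B, Γ.map (Function.eval i) ≤ ENNReal.ofReal (C i) • vol) :
    ∃ g : E → ℝ, Γ.map (weightedSum lam) = vol.withDensity (fun x => ENNReal.ofReal (g x)) ∧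
      eLpNorm g ⊤ vol ≤
        ENNReal.ofReal ((∑ i ∈ B, lam i / C i ^ ((1 : ℝ) / n)) ^ (-(n : ℝ))) := by
  have hS : SwapMonotoneOn lam Γ.support := fun m a ha i σ =>
    sum_inner_add_sq_nonpos hlam hsum a i σ
      (sum_cost_le_sum_cost_update (continuous_weightedVar lam) hopt a ha i σ)
  obtain ⟨T, hT, hLip, hcyc⟩ := hS.exists_maps hlam
  have hcl := hS.isClosed_image hlam Γ.isClosed_support
  have hm : Measurable (weightedSum lam : (ι → E) → E) := (continuous_weightedSum lam).measurable
  have : IsProbabilityMeasure (Γ.map (weightedSum lam)) :=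
    Measure.isProbabilityMeasure_map hm.aemeasurable
  refine exists_density_of_measure_le_image hn hE vol hcl.measurableSet hlam hLip hcyc ?_ _ hB hC
    fun i hi A hA => ?_
  · rintro _ ⟨a, ha, rfl⟩
    simp only [hT a ha]
    rfl
  · calc Γ.map (weightedSum lam) A = Γ (weightedSum lam ⁻¹' A ∩ Γ.support) := by
          rw [Measure.map_apply hm hA, measure_inter_conull Γ.measure_compl_support]
      _ ≤ Γ (Function.eval i ⁻¹' (T i '' (A ∩ weightedSum lam '' Γ.support))) := by
          refine measure_mono fun a ha => ⟨weightedSum lam a, ⟨ha.1, a, ha.2, rfl⟩, hT a ha.2 i⟩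
      _ ≤ Γ.map (Function.eval i) (T i '' (A ∩ weightedSum lam '' Γ.support)) :=
          Measure.le_map_apply (measurable_pi_apply i).aemeasurable _
      _ ≤ _ := hμ i hi _

end Barycentric

section Coupling

/-- Existence of an optimal coupling for a continuous nonnegative cost. -/
lemma exists_optimal_coupling {X Y : Type*} [TopologicalSpace X] [PolishSpace X]
    [MeasurableSpace X] [BorelSpace X] [TopologicalSpace Y] [PolishSpace Y] [MeasurableSpace Y]
    [BorelSpace Y] (μ : Measure X) (ν : Measure Y) [IsProbabilityMeasure μ]
    [IsProbabilityMeasure ν] {c : X × Y → NNReal} (hc : Continuous c) :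
    ∃ γ : Measure (X × Y), γ.map Prod.fst = μ ∧ γ.map Prod.snd = ν ∧
      ∀ γ' : Measure (X × Y), γ'.map Prod.fst = μ → γ'.map Prod.snd = ν →
        ∫⁻ p, c p ∂γ ≤ ∫⁻ p, c p ∂γ' := by
  let := TopologicalSpace.upgradeIsCompletelyMetrizable X
  let := TopologicalSpace.upgradeIsCompletelyMetrizable Y
  let S : Set (ProbabilityMeasure (X × Y)) :=
    {γ | γ.map continuous_fst.measurable.aemeasurable = ⟨μ, inferInstance⟩ ∧
      γ.map continuous_snd.measurable.aemeasurable = ⟨ν, inferInstance⟩}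
  have hmem (γ : ProbabilityMeasure (X × Y)) : γ ∈ S ↔
      (γ : Measure (X × Y)).map Prod.fst = μ ∧ (γ : Measure (X × Y)).map Prod.snd = ν :=
    and_congr ProbabilityMeasure.toMeasure_injective.eq_iff.symm
      ProbabilityMeasure.toMeasure_injective.eq_iff.symm
  have hScl : IsClosed S :=
    (isClosed_singleton.preimage (ProbabilityMeasure.continuous_map continuous_fst)).inter
      (isClosed_singleton.preimage (ProbabilityMeasure.continuous_map continuous_snd))
  have hStight : IsTightMeasureSet
      {((γ : ProbabilityMeasure (X × Y)) : Measure (X × Y)) | γ ∈ S} := by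
    refine IsTightMeasureSet.prodMk (isTightMeasureSet_singleton (μ := μ) |>.subset ?_)
      (isTightMeasureSet_singleton (μ := ν) |>.subset ?_)
    · rintro _ ⟨_, ⟨γ, hγ, rfl⟩, rfl⟩
      exact ((hmem γ).1 hγ).1
    · rintro _ ⟨_, ⟨γ, hγ, rfl⟩, rfl⟩
      exact ((hmem γ).1 hγ).2
  have hScomp : IsCompact S := by
    simpa only [hScl.closure_eq] using isCompact_closure_of_isTightMeasureSet hStight
  have hlsc : LowerSemicontinuous fun γ : ProbabilityMeasure (X × Y) =>
      ∫⁻ p, c p ∂(γ : Measure (X × Y)) := by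
    have heq : (fun γ : ProbabilityMeasure (X × Y) => ∫⁻ p, c p ∂(γ : Measure (X × Y))) =
        fun γ : ProbabilityMeasure (X × Y) => ⨆ k : ℕ, ∫⁻ p, (min (k : NNReal) (c p) : NNReal) ∂(γ : Measure (X × Y)) := by
      funext γ
      rw [← lintegral_iSup (fun k => by fun_prop) fun k l hkl p => by
        simp only [ENNReal.coe_le_coe]; gcongr]
      refine lintegral_congr fun p => le_antisymm ?_ (iSup_le fun k => by simp)
      obtain ⟨k, hk⟩ := exists_nat_ge (c p)
      refine le_iSup_of_le k ?_
      rw [min_eq_right hk]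
    rw [heq]
    refine lowerSemicontinuous_iSup fun k => Continuous.lowerSemicontinuous ?_
    let f : BoundedContinuousFunction (X × Y) NNReal :=
      BoundedContinuousFunction.mkOfBound ⟨fun p => min (k : NNReal) (c p), by fun_prop⟩ k
        fun p q => by
          rw [NNReal.dist_eq]
          refine abs_sub_le_of_nonneg_of_le (by positivity) ?_ (by positivity) ?_ <;>
          exact_mod_cast min_le_left _ _
    exact ProbabilityMeasure.continuous_lintegral_boundedContinuousFunction f
  have hne : S.Nonempty := by
    refine ⟨⟨μ.prod ν, inferInstance⟩, (hmem _).2 ⟨?_, ?_⟩⟩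
    · simp
    · simp
  obtain ⟨γ, hγ, hmin⟩ := (hlsc.lowerSemicontinuousOn S).exists_isMinOn hne hScomp
  refine ⟨γ, ((hmem γ).1 hγ).1, ((hmem γ).1 hγ).2, fun γ' h1 h2 => ?_⟩
  have hp : IsProbabilityMeasure γ' := by
    constructor
    rw [← measure_univ (μ := μ), ← h1, Measure.map_apply measurable_fst MeasurableSet.univ,
      preimage_univ]
  exact hmin (a := ⟨γ', hp⟩) ((hmem _).2 ⟨h1, h2⟩)

open ProbabilityTheory in
/-- Gluing of finitely many couplings along a common first marginal. -/
lemma exists_gluing {ι X Y : Type*} [Fintype ι] [MeasurableSpace X] [MeasurableSpace Y]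
    [StandardBorelSpace Y] [Nonempty Y] (μ : Measure X) [IsProbabilityMeasure μ]
    (γ : ι → Measure (X × Y)) (hγ : ∀ i, (γ i).map Prod.fst = μ) :
    ∃ Γ : Measure (X × (ι → Y)), IsProbabilityMeasure Γ ∧ Γ.map Prod.fst = μ ∧
      ∀ i, Γ.map (fun p => (p.1, p.2 i)) = γ i := by
  classical
  have hprob (i : ι) : IsProbabilityMeasure (γ i) := by
    constructor
    rw [← measure_univ (μ := μ), ← hγ i, Measure.map_apply measurable_fst MeasurableSet.univ,
      preimage_univ]
  let κ : ι → Kernel X Y := fun i => (γ i).condKernel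
  have hκ : Measurable fun x => Measure.pi fun i => κ i x := by
    refine Measurable.measure_of_isPiSystem_of_isProbabilityMeasure
      generateFrom_pi.symm isPiSystem_pi ?_
    rintro _ ⟨s, hs, rfl⟩
    simp only [Measure.pi_pi]
    exact Finset.measurable_prod _ fun i _ => (κ i).measurable_coe (hs i (mem_univ i))
  let K : Kernel X (ι → Y) := ⟨fun x => Measure.pi fun i => κ i x, hκ⟩
  have hK : IsMarkovKernel K := ⟨fun x => by
    change IsProbabilityMeasure (Measure.pi fun i => κ i x)
    infer_instance⟩
  refine ⟨μ ⊗ₘ K, inferInstance, Measure.fst_compProd μ K, fun i => ?_⟩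
  have hmap : K.map (Function.eval i) = κ i := by
    ext1 x
    rw [Kernel.map_apply _ (measurable_pi_apply i)]
    change (Measure.pi fun i => κ i x).map (Function.eval i) = κ i x
    rw [Measure.pi_map_eval, Finset.prod_eq_one fun j _ => measure_univ, one_smul]
  have h := Measure.compProd_map (μ := μ) (κ := K) (measurable_pi_apply i)
  rw [hmap] at h
  calc (μ ⊗ₘ K).map (fun p => (p.1, p.2 i)) = μ ⊗ₘ κ i := h.symm
    _ = γ i := by
      rw [← hγ i]
      exact (γ i).disintegrate (γ i).condKernel

end Coupling

section Wasserstein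

variable {n : ℕ} {Ω : Type*} [MeasurableSpace Ω] {P : Measure Ω}

lemma finSecMom_map_iff {f : Ω → En n} (hf : Measurable f) :
    FinSecMom (P.map f) ↔ MemLp f 2 P := by
  rw [FinSecMom, integrable_map_measure (by fun_prop) hf.aemeasurable,
    memLp_two_iff_integrable_sq_norm hf.aestronglyMeasurable]
  rfl

lemma integrable_norm_sub_sq {f g : Ω → En n} (hf : MemLp f 2 P) (hg : MemLp g 2 P) :
    Integrable (fun ω => ‖f ω - g ω‖ ^ 2) P :=
  (memLp_two_iff_integrable_sq_norm (hf.sub hg).1).1 (hf.sub hg)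

lemma IsCoupling.integrable {γ : Measure (En n × En n)} {μ ν : Measure (En n)}
    (h : IsCoupling γ μ ν) (hμ : FinSecMom μ) (hν : FinSecMom ν) :
    Integrable (fun p => ‖p.1 - p.2‖ ^ 2) γ :=
  integrable_norm_sub_sq ((finSecMom_map_iff measurable_fst).1 (h.1 ▸ hμ))
    ((finSecMom_map_iff measurable_snd).1 (h.2 ▸ hν))

lemma IsCoupling.W2sq_le {γ : Measure (En n × En n)} {μ ν : Measure (En n)}
    (h : IsCoupling γ μ ν) : W2sq μ ν ≤ ∫ p, ‖p.1 - p.2‖ ^ 2 ∂γ := by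
  refine csInf_le ⟨0, ?_⟩ ⟨γ, h, rfl⟩
  rintro _ ⟨γ', -, rfl⟩
  positivity

lemma W2sq_map_le {f g : Ω → En n} (hf : Measurable f) (hg : Measurable g) :
    W2sq (P.map f) (P.map g) ≤ ∫ ω, ‖f ω - g ω‖ ^ 2 ∂P := by
  have hfg : Measurable fun ω => (f ω, g ω) := hf.prodMk hg
  have h : IsCoupling (P.map fun ω => (f ω, g ω)) (P.map f) (P.map g) :=
    ⟨Measure.map_map measurable_fst hfg, Measure.map_map measurable_snd hfg⟩
  refine h.W2sq_le.trans_eq ?_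
  rw [integral_map hfg.aemeasurable (by fun_prop)]

lemma exists_isCoupling_W2sq_eq (μ ν : Measure (En n)) [IsProbabilityMeasure μ]
    [IsProbabilityMeasure ν] (hμ : FinSecMom μ) (hν : FinSecMom ν) :
    ∃ γ, IsCoupling γ μ ν ∧ W2sq μ ν = ∫ p, ‖p.1 - p.2‖ ^ 2 ∂γ := by
  obtain ⟨γ, h1, h2, hopt⟩ := exists_optimal_coupling μ ν
    (c := fun p : En n × En n => ‖p.1 - p.2‖₊ ^ 2) (by fun_prop)
  have hγ : IsCoupling γ μ ν := ⟨h1, h2⟩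
  refine ⟨γ, hγ, le_antisymm hγ.W2sq_le (le_csInf ⟨_, γ, hγ, rfl⟩ ?_)⟩
  rintro _ ⟨γ', hγ', rfl⟩
  have hreal (p : En n × En n) :
      ENNReal.ofReal (‖p.1 - p.2‖ ^ 2) = ((‖p.1 - p.2‖₊ ^ 2 : NNReal) : ℝ≥0∞) := by
    rw [← coe_nnnorm, ← NNReal.coe_pow, ENNReal.ofReal_coe_nnreal]
  rw [← ENNReal.ofReal_le_ofReal_iff (by positivity),
    ofReal_integral_eq_lintegral_ofReal (hγ.integrable hμ hν) (ae_of_all _ fun p => by positivity),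
    ofReal_integral_eq_lintegral_ofReal (hγ'.integrable hμ hν)
      (ae_of_all _ fun p => by positivity)]
  simp only [hreal]
  exact hopt γ' hγ'.1 hγ'.2

variable {ι : Type*} [Fintype ι] {lam : ι → ℝ}

lemma memLp_weightedSum {A : Ω → ι → En n} (hA : ∀ i, MemLp (fun ω => A ω i) 2 P) :
    MemLp (fun ω => weightedSum lam (A ω)) 2 P :=
  memLp_finsetSum _ fun i _ => (hA i).const_smul (lam i)

lemma integrable_weightedVar {Γ : Measure (ι → En n)}
    (hΓ : ∀ i : ι, FinSecMom (Γ.map (Function.eval i))) : Integrable (weightedVar lam) Γ := by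
  have hA (i : ι) : MemLp (fun a : ι → En n => a i) 2 Γ :=
    (finSecMom_map_iff (measurable_pi_apply i)).1 (hΓ i)
  exact integrable_finsetSum _ fun i _ =>
    (integrable_norm_sub_sq (hA i) (memLp_weightedSum hA)).const_mul _

lemma sum_W2sq_le_integral_weightedVar (hlam : ∀ i, 0 < lam i) {Γ : Measure (ι → En n)}
    (hΓ : ∀ i : ι, FinSecMom (Γ.map (Function.eval i))) :
    ∑ i, lam i * W2sq (Γ.map (weightedSum lam)) (Γ.map (Function.eval i)) ≤
      ∫ a, weightedVar lam a ∂Γ := by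
  have hA (i : ι) : MemLp (fun a : ι → En n => a i) 2 Γ :=
    (finSecMom_map_iff (measurable_pi_apply i)).1 (hΓ i)
  simp only [weightedVar]
  rw [integral_finsetSum _ fun i _ =>
    (integrable_norm_sub_sq (hA i) (memLp_weightedSum hA)).const_mul _]
  refine Finset.sum_le_sum fun i _ => ?_
  rw [integral_const_mul]
  refine mul_le_mul_of_nonneg_left ?_ (hlam i).le
  simp only [norm_sub_rev _ (weightedSum lam _)]
  exact W2sq_map_le (continuous_weightedSum lam).measurable (measurable_pi_apply i)

/-- A Wasserstein barycentre is the law of the weighted sum under a multi-marginal plan minimizing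
the expected weighted variance. -/
lemma exists_optimal_plan (hlam : ∀ i, 0 < lam i) (hsum : ∑ i, lam i = 1)
    {μs : ι → Measure (En n)} (hps : ∀ i, IsProbabilityMeasure (μs i))
    (hmom : ∀ i, FinSecMom (μs i)) {μ : Measure (En n)} [IsProbabilityMeasure μ]
    (hμ : FinSecMom μ)
    (hmin : ∀ ν : Measure (En n), IsProbabilityMeasure ν → FinSecMom ν →
      ∑ i, lam i * W2sq μ (μs i) ≤ ∑ i, lam i * W2sq ν (μs i)) :
    ∃ Γ : Measure (ι → En n), IsProbabilityMeasure Γ ∧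
      (∀ i : ι, Γ.map (Function.eval i) = μs i) ∧ Γ.map (weightedSum lam) = μ ∧
      ∀ Γ' : Measure (ι → En n), IsProbabilityMeasure Γ' →
        (∀ i : ι, Γ'.map (Function.eval i) = μs i) →
        Integrable (weightedVar lam) Γ' ∧
          ∫ a, weightedVar lam a ∂Γ ≤ ∫ a, weightedVar lam a ∂Γ' := by
  have hm : Measurable (weightedSum lam : (ι → En n) → En n) :=
    (continuous_weightedSum lam).measurable
  have hbound (Γ' : Measure (ι → En n)) (hΓ' : IsProbabilityMeasure Γ')
      (hmarg : ∀ i : ι, Γ'.map (Function.eval i) = μs i) :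
      ∑ i, lam i * W2sq μ (μs i) ≤ ∫ a, weightedVar lam a ∂Γ' := by
    have hmom' (i : ι) : FinSecMom (Γ'.map (Function.eval i)) := hmarg i ▸ hmom i
    have h := sum_W2sq_le_integral_weightedVar hlam hmom'
    simp only [hmarg] at h
    refine (hmin _ (Measure.isProbabilityMeasure_map hm.aemeasurable) ?_).trans h
    exact (finSecMom_map_iff hm).2 (memLp_weightedSum fun i =>
      (finSecMom_map_iff (measurable_pi_apply i)).1 (hmom' i))
  choose γ hγ hγeq using fun i => exists_isCoupling_W2sq_eq μ (μs i) hμ (hmom i)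
  obtain ⟨P, hP, hP1, hPγ⟩ := exists_gluing μ γ fun i => (hγ i).1
  have hpair (i : ι) : Measurable fun p : En n × (ι → En n) => (p.1, p.2 i) := by fun_prop
  have hPi (i : ι) : P.map (fun p => p.2 i) = μs i := by
    rw [← (hγ i).2, ← hPγ i, Measure.map_map measurable_snd (hpair i)]
    rfl
  have hX : MemLp (fun p : En n × (ι → En n) => p.1) 2 P :=
    (finSecMom_map_iff measurable_fst).1 (hP1 ▸ hμ)
  have hA (i : ι) : MemLp (fun p : En n × (ι → En n) => p.2 i) 2 P :=
    (finSecMom_map_iff (by fun_prop)).1 (hPi i ▸ hmom i)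
  have hΓ : IsProbabilityMeasure (P.map Prod.snd) :=
    Measure.isProbabilityMeasure_map measurable_snd.aemeasurable
  have hmarg (i : ι) : (P.map Prod.snd).map (Function.eval i) = μs i := by
    rw [Measure.map_map (measurable_pi_apply i) measurable_snd, ← hPi i]
    rfl
  have hvar : ∫ a, weightedVar lam a ∂(P.map Prod.snd) = ∫ p, weightedVar lam p.2 ∂P :=
    integral_map measurable_snd.aemeasurable (continuous_weightedVar lam).aestronglyMeasurable
  have hvarint : Integrable (fun p : En n × (ι → En n) => weightedVar lam p.2) P :=
    (integrable_weightedVar fun i : ι => (hmarg i).symm ▸ hmom i).comp_measurable measurable_snd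
  have hdiff : Integrable (fun p : En n × (ι → En n) => ‖p.1 - weightedSum lam p.2‖ ^ 2) P :=
    integrable_norm_sub_sq hX (memLp_weightedSum hA)
  have hsplit (x : En n) (a : ι → En n) : ∑ i, lam i * ‖x - a i‖ ^ 2 =
      weightedVar lam a + ‖x - weightedSum lam a‖ ^ 2 := by
    rw [sum_mul_norm_sub_sq hsum, weightedVar_eq hsum, norm_sub_sq_real]
    ring
  have hV : ∑ i, lam i * W2sq μ (μs i) = ∫ a, weightedVar lam a ∂(P.map Prod.snd) +
      ∫ p, ‖p.1 - weightedSum lam p.2‖ ^ 2 ∂P := by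
    rw [hvar, ← integral_add hvarint hdiff]
    simp only [← hsplit]
    rw [integral_finsetSum _ fun i _ => (integrable_norm_sub_sq hX (hA i)).const_mul _]
    refine Finset.sum_congr rfl fun i _ => ?_
    rw [integral_const_mul, hγeq i, ← hPγ i, integral_map (hpair i).aemeasurable (by fun_prop)]
  have hle := hbound _ hΓ hmarg
  have hzero : ∫ p, ‖p.1 - weightedSum lam p.2‖ ^ 2 ∂P = 0 :=
    le_antisymm (by linarith) (by positivity)
  have hae : (fun p : En n × (ι → En n) => p.1) =ᵐ[P] fun p => weightedSum lam p.2 := by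
    filter_upwards [(integral_eq_zero_iff_of_nonneg (fun p => by positivity) hdiff).1 hzero]
      with p hp
    exact sub_eq_zero.1 (norm_eq_zero.1 (pow_eq_zero_iff two_ne_zero |>.1 hp))
  refine ⟨P.map Prod.snd, hΓ, hmarg, ?_, fun Γ' hΓ' hmarg' => ⟨?_, ?_⟩⟩
  · rw [Measure.map_map hm measurable_snd, ← hP1]
    exact (Measure.map_congr hae).symm
  · exact integrable_weightedVar fun i : ι => (hmarg' i).symm ▸ hmom i
  · have := hbound Γ' hΓ' hmarg'
    linarith

end Wasserstein

lemma withDensity_ofReal_le_smul {X : Type*} [MeasurableSpace X] {vol : Measure X} {g : X → ℝ}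
    {C : ℝ} (hC : eLpNorm g ⊤ vol = ENNReal.ofReal C) :
    vol.withDensity (fun x => ENNReal.ofReal (g x)) ≤ ENNReal.ofReal C • vol := by
  rw [← withDensity_const]
  refine withDensity_mono ?_
  rw [eLpNorm_exponent_top] at hC
  filter_upwards [ae_le_eLpNormEssSup (f := g) (μ := vol)] with x hx
  exact (Real.ofReal_le_enorm _).trans (hC ▸ hx)

/-- `L^∞` bound on the density of a weighted Wasserstein barycenter of finitely
many measures, some of which have `L^∞` densities. -/
theorem stmt6 {n N : ℕ} (hn : 0 < n) (μs : Fin N → Measure (En n))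
    (hps : ∀ i, IsProbabilityMeasure (μs i)) (hmom : ∀ i, FinSecMom (μs i))
    (lam : Fin N → ℝ) (hlam : ∀ i, lam i ∈ Ioo (0:ℝ) 1) (hsum : ∑ i, lam i = 1)
    (μ : Measure (En n)) [IsProbabilityMeasure μ] (hμmom : FinSecMom μ)
    (hmin : ∀ ν : Measure (En n), IsProbabilityMeasure ν → FinSecMom ν →
      ∑ i, lam i * W2sq μ (μs i) ≤ ∑ i, lam i * W2sq ν (μs i))
    (B : Finset (Fin N)) (hB : B.Nonempty)
    (g : Fin N → En n → ℝ) (C : Fin N → ℝ)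
    (hg : ∀ i ∈ B, μs i = volume.withDensity (fun x => ENNReal.ofReal (g i x)))
    (hC : ∀ i ∈ B, eLpNorm (g i) ⊤ volume = ENNReal.ofReal (C i))
    (hCpos : ∀ i ∈ B, 0 < C i) :
    ∃ gb : En n → ℝ, μ = volume.withDensity (fun x => ENNReal.ofReal (gb x)) ∧
      eLpNorm gb ⊤ volume ≤
        ENNReal.ofReal ((∑ i ∈ B, lam i / C i ^ ((1:ℝ) / n)) ^ (-(n:ℝ))) := by
  have hlam0 (i : Fin N) : 0 < lam i := (hlam i).1
  obtain ⟨Γ, hΓ, hmarg, rfl, hopt⟩ := exists_optimal_plan hlam0 hsum hps hmom hμmom hmin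
  refine exists_density_of_optimal_plan hn finrank_euclideanSpace_fin volume hlam0 hsum
    (fun Γ' hΓ' h => hopt Γ' hΓ' fun i => (h i).trans (hmarg i)) hB hCpos fun i hi => ?_
  rw [hmarg i, hg i hi]
  exact withDensity_ofReal_le_smul (hC i hi)
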